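/- Let n ≥ 1, let Q : ℝ^n × ℝ^n → ℝ^n be bilinear, and for u ∈ ℝ^n let Q_u(x,y) := Q(x,y) + (u_1 x_1 y_1, …, u_n x_n y_n). Then for Lebesgue-almost every u ∈ ℝ^n the following holds: for every θ ∈ (0,1) there exists a constant C_{u,θ} such that for all ε > 0, the Lebesgue measure of { t ∈ [-1,1]^n : |det Q_u(·, t)| ≤ ε } is at most C_{u,θ} · ε^θ, where det Q_u(·,t) is the determinant of the linear map v ↦ Q_u(v,t). -/

import Mathlib

open MeasureTheory
open scoped ENNReal

/-- The linear map `v ↦ Q_u(v, t)`, where `Q_u(x,y) = Q(x,y) + (u₁x₁y₁, …, uₙxₙyₙ)`. -/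
noncomputable def QuFlip {n : ℕ} (Q : (Fin n → ℝ) →ₗ[ℝ] (Fin n → ℝ) →ₗ[ℝ] (Fin n → ℝ))
    (u t : Fin n → ℝ) : (Fin n → ℝ) →ₗ[ℝ] (Fin n → ℝ) :=
  Q.flip t + LinearMap.pi fun i => (u i * t i) • LinearMap.proj i

/-- A negative power of `|y|` is bounded by `1` plus its restrictions to `(0,1]` and `[-1,0)`. -/
lemma enorm_rpow_neg_le_one_add_indicator {θ : ℝ} (hθ : 0 ≤ θ) {y : ℝ} (hy : y ≠ 0) :
    ‖y‖ₑ ^ (-θ) ≤ 1 + ((Set.Ioc (0 : ℝ) 1).indicator (fun x => ‖x‖ₑ ^ (-θ)) y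
      + (Set.Ioc (0 : ℝ) 1).indicator (fun x => ‖x‖ₑ ^ (-θ)) (-y)) := by
  by_cases h1 : |y| ≤ 1
  · rcases lt_or_gt_of_ne hy with h | h
    · have hm : -y ∈ Set.Ioc (0 : ℝ) 1 := ⟨by linarith, by linarith [(abs_le.1 h1).1]⟩
      rw [Set.indicator_of_mem hm, enorm_neg, ← add_assoc]
      exact le_add_self
    · have hm : y ∈ Set.Ioc (0 : ℝ) 1 := ⟨h, (abs_le.1 h1).2⟩
      rw [Set.indicator_of_mem hm, add_left_comm]
      exact le_self_add
  · refine le_trans ?_ le_self_add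
    rw [ENNReal.rpow_neg, ENNReal.inv_le_one]
    have h : 1 ≤ ‖y‖ₑ := by
      rw [← ofReal_norm, Real.norm_eq_abs, ENNReal.one_le_ofReal]
      exact (not_le.1 h1).le
    simpa using ENNReal.rpow_le_rpow h hθ

lemma lintegral_Ioc_enorm_rpow_neg_ne_top {θ : ℝ} (hθ : θ < 1) :
    ∫⁻ x in Set.Ioc (0 : ℝ) 1, ‖x‖ₑ ^ (-θ) ≠ ∞ := by
  have h : IntegrableOn (fun x : ℝ => x ^ (-θ)) (Set.Ioc 0 1) :=
    (intervalIntegrable_iff_integrableOn_Ioc_of_le zero_le_one).1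
      (intervalIntegral.intervalIntegrable_rpow' (by linarith))
  refine ne_of_eq_of_ne (setLIntegral_congr_fun measurableSet_Ioc fun x hx => ?_) h.2.ne
  rw [Real.enorm_eq_ofReal hx.1.le, Real.enorm_eq_ofReal (Real.rpow_nonneg hx.1.le _),
    ENNReal.ofReal_rpow_of_pos hx.1]

/-- Negative powers of affine functions of one variable are integrable on bounded intervals,
uniformly in the constant term. -/
lemma exists_setLIntegral_affine_rpow_neg_le {θ : ℝ} (hθ₀ : 0 ≤ θ) (hθ : θ < 1) (R : ℝ) :
    ∃ C : ℝ≥0∞, C ≠ ∞ ∧ ∀ a b : ℝ,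
      ∫⁻ x in Set.Icc (-R) R, ‖x * a + b‖ₑ ^ (-θ) ≤ C * ‖a‖ₑ ^ (-θ) := by
  set g : ℝ → ℝ≥0∞ := (Set.Ioc (0 : ℝ) 1).indicator (fun x => ‖x‖ₑ ^ (-θ))
  have hgm : Measurable g := by
    refine Measurable.indicator ?_ measurableSet_Ioc
    fun_prop
  have hgI : ∫⁻ x, g x ≠ ∞ := by
    rw [lintegral_indicator measurableSet_Ioc]
    exact lintegral_Ioc_enorm_rpow_neg_ne_top hθ
  refine ⟨1 + volume (Set.Icc (-R) R) + ((∫⁻ x, g x) + ∫⁻ x, g x), ?_, fun a b => ?_⟩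
  · simp [hgI]
  rcases eq_or_ne a 0 with rfl | ha
  · rcases eq_or_lt_of_le hθ₀ with rfl | h
    · simp only [neg_zero, ENNReal.rpow_zero, mul_one, lintegral_const, one_mul,
        Measure.restrict_apply_univ, add_assoc]
      exact le_add_left le_self_add
    · rw [enorm_zero, ENNReal.zero_rpow_of_neg (by linarith), ENNReal.mul_top (by simp)]
      exact le_top
  set c := b / a
  have key : ∫⁻ x in Set.Icc (-R) R, ‖x + c‖ₑ ^ (-θ)
      ≤ volume (Set.Icc (-R) R) + ((∫⁻ x, g x) + ∫⁻ x, g x) := by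
    have hne : ∀ᵐ x : ℝ, x + c ≠ 0 := by
      refine measure_mono_null (t := {-c}) (fun x hx => ?_) (by simp)
      simp only [ne_eq, Set.mem_compl_iff, Set.mem_ofPred_eq, not_not] at hx
      exact eq_neg_of_add_eq_zero_left hx
    have hg₁ : ∫⁻ x, g (x + c) = ∫⁻ x, g x := lintegral_add_right_eq_self g c
    have hg₂ : ∫⁻ x, g (-(x + c)) = ∫⁻ x, g x := by
      rw [lintegral_add_right_eq_self (fun x => g (-x)) c]
      exact lintegral_neg_eq_self g
    calc ∫⁻ x in Set.Icc (-R) R, ‖x + c‖ₑ ^ (-θ)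
        ≤ ∫⁻ x in Set.Icc (-R) R, (1 + (g (x + c) + g (-(x + c)))) := by
          refine lintegral_mono_ae ((ae_restrict_of_ae hne).mono fun x hx => ?_)
          exact enorm_rpow_neg_le_one_add_indicator hθ₀ hx
      _ = volume (Set.Icc (-R) R) + ∫⁻ x in Set.Icc (-R) R, (g (x + c) + g (-(x + c))) := by
          rw [lintegral_add_left measurable_const]
          simp
      _ ≤ volume (Set.Icc (-R) R) + ∫⁻ x, (g (x + c) + g (-(x + c))) := by
          gcongr
          exact Measure.restrict_le_self
      _ = _ := by
          rw [lintegral_add_left (by fun_prop), hg₁, hg₂]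
  have hfac : ∀ x : ℝ, ‖x * a + b‖ₑ ^ (-θ) = ‖x + c‖ₑ ^ (-θ) * ‖a‖ₑ ^ (-θ) := fun x => by
    rw [← ENNReal.mul_rpow_of_ne_top enorm_ne_top enorm_ne_top, ← enorm_mul]
    congr 2
    simp only [c]
    field_simp
  simp_rw [hfac]
  rw [lintegral_mul_const _ (by fun_prop)]
  gcongr
  rw [add_assoc]
  exact key.trans le_add_self

/-- Expanding `det (M + diag (u * s))` in the variable `u 0`. -/
lemma Matrix.det_add_diagonal_cons {R : Type*} [CommRing R] {n : ℕ}
    (M : Matrix (Fin (n + 1)) (Fin (n + 1)) R) (s : Fin (n + 1) → R) (x : R) (v : Fin n → R) :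
    (M + Matrix.diagonal ((Fin.cons x v : Fin (n + 1) → R) * s)).det =
      x * (s 0 * (M.submatrix Fin.succ Fin.succ + Matrix.diagonal (v * Fin.tail s)).det)
        + (M + Matrix.diagonal ((Fin.cons 0 v : Fin (n + 1) → R) * s)).det := by
  have hsub : ∀ y : R, ∀ j : Fin (n + 1),
      (M + Matrix.diagonal ((Fin.cons y v : Fin (n + 1) → R) * s)).submatrix Fin.succ j.succAbove
        = (M + Matrix.diagonal ((Fin.cons 0 v : Fin (n + 1) → R) * s)).submatrix
          Fin.succ j.succAbove := by
    intro y j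
    ext i k
    simp [Matrix.diagonal_apply]
  have hzero : (M + Matrix.diagonal ((Fin.cons 0 v : Fin (n + 1) → R) * s)).submatrix
      Fin.succ (Fin.succAbove 0)
        = M.submatrix Fin.succ Fin.succ + Matrix.diagonal (v * Fin.tail s) := by
    ext i k
    simp [Matrix.diagonal_apply, Fin.tail]
  rw [Matrix.det_succ_row_zero, Matrix.det_succ_row_zero
    (M + Matrix.diagonal ((Fin.cons 0 v : Fin (n + 1) → R) * s))]
  simp_rw [hsub x]
  rw [Fin.sum_univ_succ, Fin.sum_univ_succ, hzero]
  simp only [Matrix.add_apply, Matrix.diagonal_apply, Fin.val_zero, pow_zero, Pi.mul_apply,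
    Fin.cons_zero, if_true, (Fin.succ_ne_zero _).symm, if_false]
  ring

/-- Integrating a negative power of `det (M + diag (u * s))` over `u` gives a bound independent
of `M`. -/
lemma lintegral_det_add_diagonal_rpow_neg_le {θ : ℝ} {μ : Measure ℝ} [SigmaFinite μ] {C : ℝ≥0∞}
    (hC : ∀ a b : ℝ, ∫⁻ x, ‖x * a + b‖ₑ ^ (-θ) ∂μ ≤ C * ‖a‖ₑ ^ (-θ)) (n : ℕ)
    (M : Matrix (Fin n) (Fin n) ℝ) (s : Fin n → ℝ) :
    ∫⁻ u, ‖(M + Matrix.diagonal (u * s)).det‖ₑ ^ (-θ) ∂(Measure.pi fun _ => μ)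
      ≤ C ^ n * ‖∏ i, s i‖ₑ ^ (-θ) := by
  induction n with
  | zero => simp
  | succ n ih =>
    have hmeas : Measurable fun u : Fin (n + 1) → ℝ =>
        ‖(M + Matrix.diagonal (u * s)).det‖ₑ ^ (-θ) := by
      have : Continuous fun u : Fin (n + 1) → ℝ => (M + Matrix.diagonal (u * s)).det := by
        fun_prop
      exact this.measurable.enorm.pow_const _
    have hmp := (measurePreserving_piFinSuccAbove (fun _ : Fin (n + 1) => μ) 0).symm
    rw [← hmp.lintegral_comp hmeas, lintegral_prod_symm]
    swap
    · exact (hmeas.comp hmp.measurable).aemeasurable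
    have hcons : ∀ (x : ℝ) (v : Fin n → ℝ),
        (MeasurableEquiv.piFinSuccAbove (fun _ : Fin (n + 1) => ℝ) 0).symm (x, v)
          = (Fin.cons x v : Fin (n + 1) → ℝ) := fun x v => by
      simp [MeasurableEquiv.piFinSuccAbove, Fin.insertNthEquiv]
    simp_rw [hcons]
    calc _ ≤ ∫⁻ v, C * (‖s 0‖ₑ ^ (-θ) *
            ‖(M.submatrix Fin.succ Fin.succ + Matrix.diagonal (v * Fin.tail s)).det‖ₑ ^ (-θ))
            ∂(Measure.pi fun _ => μ) := by
          refine lintegral_mono fun v => ?_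
          have hexp := fun x => Matrix.det_add_diagonal_cons M s x v
          refine ((lintegral_congr fun x => by rw [hexp x]).trans_le (hC _ _)).trans_eq ?_
          rw [enorm_mul, ENNReal.mul_rpow_of_ne_top enorm_ne_top enorm_ne_top]
      _ = C * (‖s 0‖ₑ ^ (-θ) * ∫⁻ v,
            ‖(M.submatrix Fin.succ Fin.succ + Matrix.diagonal (v * Fin.tail s)).det‖ₑ ^ (-θ)
            ∂(Measure.pi fun _ => μ)) := by
          have hm : Measurable fun v : Fin n → ℝ =>
              ‖(M.submatrix Fin.succ Fin.succ
                + Matrix.diagonal (v * Fin.tail s)).det‖ₑ ^ (-θ) := by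
            have : Continuous fun v : Fin n → ℝ =>
                (M.submatrix Fin.succ Fin.succ + Matrix.diagonal (v * Fin.tail s)).det := by
              fun_prop
            exact this.measurable.enorm.pow_const _
          rw [lintegral_const_mul _ (hm.const_mul _), lintegral_const_mul _ hm]
      _ ≤ C * (‖s 0‖ₑ ^ (-θ) * (C ^ n * ‖∏ i, Fin.tail s i‖ₑ ^ (-θ))) := by
          gcongr
          exact ih _ _
      _ = C ^ (n + 1) * ‖∏ i, s i‖ₑ ^ (-θ) := by
          rw [Fin.prod_univ_succ, enorm_mul,
            ENNReal.mul_rpow_of_ne_top enorm_ne_top enorm_ne_top, pow_succ]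
          simp only [Fin.tail]
          ring

lemma det_QuFlip {n : ℕ} (Q : (Fin n → ℝ) →ₗ[ℝ] (Fin n → ℝ) →ₗ[ℝ] (Fin n → ℝ))
    (u t : Fin n → ℝ) :
    LinearMap.det (QuFlip Q u t)
      = (LinearMap.toMatrix' (Q.flip t) + Matrix.diagonal (u * t)).det := by
  have h : LinearMap.toMatrix' (LinearMap.pi fun i => (u i * t i) •
      (LinearMap.proj i : (Fin n → ℝ) →ₗ[ℝ] ℝ)) = Matrix.diagonal (u * t) := by
    ext i j
    simp [LinearMap.toMatrix'_apply, Matrix.diagonal_apply, Pi.single_apply]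
  rw [← LinearMap.det_toMatrix', QuFlip, map_add, h]

lemma continuous_det_QuFlip {n : ℕ} (Q : (Fin n → ℝ) →ₗ[ℝ] (Fin n → ℝ) →ₗ[ℝ] (Fin n → ℝ)) :
    Continuous fun p : (Fin n → ℝ) × (Fin n → ℝ) => LinearMap.det (QuFlip Q p.1 p.2) := by
  simp_rw [det_QuFlip]
  have h : Continuous fun t : Fin n → ℝ => LinearMap.toMatrix' (Q.flip t) :=
    (LinearMap.toMatrix'.toLinearMap ∘ₗ Q.flip).continuous_of_finiteDimensional
  have h' := h.comp (continuous_snd (X := Fin n → ℝ))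
  simp only [Function.comp_def] at h'
  fun_prop

lemma volume_restrict_Icc_pi (n : ℕ) (R : ℝ) :
    (volume : Measure (Fin n → ℝ)).restrict (Set.Icc (fun _ => -R) fun _ => R)
      = Measure.pi fun _ => volume.restrict (Set.Icc (-R) R) := by
  rw [← Set.pi_univ_Icc, volume_pi, Measure.restrict_pi_pi]

lemma ae_lintegral_det_QuFlip_ne_top {n : ℕ}
    (Q : (Fin n → ℝ) →ₗ[ℝ] (Fin n → ℝ) →ₗ[ℝ] (Fin n → ℝ)) {θ : ℝ} (hθ₀ : 0 ≤ θ) (hθ : θ < 1) :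
    ∀ᵐ u ∂(volume : Measure (Fin n → ℝ)),
      ∫⁻ t in Set.Icc (-1 : Fin n → ℝ) 1, ‖LinearMap.det (QuFlip Q u t)‖ₑ ^ (-θ) ≠ ∞ := by
  have hmeas : Measurable fun p : (Fin n → ℝ) × (Fin n → ℝ) =>
      ‖LinearMap.det (QuFlip Q p.1 p.2)‖ₑ ^ (-θ) :=
    (continuous_det_QuFlip Q).measurable.enorm.pow_const _
  have hcover : (⋃ N : ℕ, Set.Icc (fun _ : Fin n => -(N : ℝ)) fun _ => (N : ℝ)) = Set.univ := by
    refine Set.eq_univ_of_forall fun u => ?_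
    obtain ⟨N, hN⟩ := exists_nat_ge ‖u‖
    exact Set.mem_iUnion.2 ⟨N, fun i => (abs_le.1 ((norm_le_pi_norm u i).trans hN)).1,
      fun i => (abs_le.1 ((norm_le_pi_norm u i).trans hN)).2⟩
  suffices h : ∀ᵐ u ∂(volume : Measure (Fin n → ℝ)).restrict
      (⋃ N : ℕ, Set.Icc (fun _ : Fin n => -(N : ℝ)) fun _ => (N : ℝ)),
      ∫⁻ t in Set.Icc (-1 : Fin n → ℝ) 1, ‖LinearMap.det (QuFlip Q u t)‖ₑ ^ (-θ) ≠ ∞ by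
    rwa [hcover, Measure.restrict_univ] at h
  refine (ae_restrict_iUnion_iff _ _).2 fun N => ?_
  obtain ⟨C, hCtop, hC⟩ := exists_setLIntegral_affine_rpow_neg_le hθ₀ hθ (N : ℝ)
  obtain ⟨D, hDtop, hD⟩ := exists_setLIntegral_affine_rpow_neg_le hθ₀ hθ 1
  have hprod : ∫⁻ t in Set.Icc (-1 : Fin n → ℝ) 1, ‖∏ i, t i‖ₑ ^ (-θ) ≤ D ^ n := by
    have h := lintegral_det_add_diagonal_rpow_neg_le hD n 0 1
    rw [← volume_restrict_Icc_pi] at h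
    have hIcc : Set.Icc (-1 : Fin n → ℝ) 1 = Set.Icc (fun _ => -1) fun _ => 1 := rfl
    simpa [hIcc] using h
  refine (ae_lt_top hmeas.lintegral_prod_right' (ne_top_of_le_ne_top
    (ENNReal.mul_ne_top (ENNReal.pow_ne_top hCtop) (ENNReal.pow_ne_top hDtop))
    (b := C ^ n * D ^ n) ?_)).mono fun u hu => hu.ne
  rw [lintegral_lintegral_swap (f := fun u t => ‖LinearMap.det (QuFlip Q u t)‖ₑ ^ (-θ))
    hmeas.aemeasurable]
  simp_rw [det_QuFlip]
  calc _ ≤ ∫⁻ t in Set.Icc (-1 : Fin n → ℝ) 1, C ^ n * ‖∏ i, t i‖ₑ ^ (-θ) := by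
        refine lintegral_mono fun t => ?_
        rw [volume_restrict_Icc_pi]
        exact lintegral_det_add_diagonal_rpow_neg_le hC n _ t
    _ = C ^ n * ∫⁻ t in Set.Icc (-1 : Fin n → ℝ) 1, ‖∏ i, t i‖ₑ ^ (-θ) :=
        lintegral_const_mul' _ _ (ENNReal.pow_ne_top hCtop)
    _ ≤ _ := by gcongr

lemma ENNReal.rpow_neg_le_one_add_rpow_neg {θ η : ℝ} (hθ : 0 ≤ θ) (h : θ ≤ η) (x : ℝ≥0∞) :
    x ^ (-θ) ≤ 1 + x ^ (-η) := by
  rcases le_total x 1 with hx | hx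
  · exact (ENNReal.rpow_le_rpow_of_exponent_ge hx (neg_le_neg h)).trans le_add_self
  · refine le_trans ?_ le_self_add
    rw [ENNReal.rpow_neg, ENNReal.inv_le_one]
    simpa using ENNReal.rpow_le_rpow hx hθ

/-- Chebyshev's inequality for the sublevel sets of a real function. -/
lemma measure_sublevel_le_of_lintegral_rpow_neg {α : Type*} [MeasurableSpace α] {μ : Measure α}
    {s : Set α} (hs : MeasurableSet s) {f : α → ℝ} (hf : Measurable f) {θ : ℝ} (hθ : 0 ≤ θ)
    (hI : ∫⁻ t in s, ‖f t‖ₑ ^ (-θ) ∂μ ≠ ∞) {ε : ℝ} (hε : 0 < ε) :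
    μ {t ∈ s | |f t| ≤ ε} ≤
      ENNReal.ofReal ((∫⁻ t in s, ‖f t‖ₑ ^ (-θ) ∂μ).toReal * ε ^ θ) := by
  have hmarkov := meas_ge_le_lintegral_div (μ := μ.restrict s)
    (hf.enorm.pow_const (-θ)).aemeasurable (ε := ENNReal.ofReal ε ^ (-θ))
    (by simp [ENNReal.rpow_eq_zero_iff, hε]) (by simp [ENNReal.rpow_eq_top_iff, hε.not_ge])
  rw [ENNReal.ofReal_mul ENNReal.toReal_nonneg, ENNReal.ofReal_toReal hI,
    ← ENNReal.ofReal_rpow_of_pos hε]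
  rw [ENNReal.div_eq_inv_mul, ENNReal.rpow_neg, inv_inv, mul_comm] at hmarkov
  refine le_trans ?_ hmarkov
  rw [Measure.restrict_apply' hs]
  refine measure_mono fun t ht => ⟨?_, ht.1⟩
  rw [Set.mem_ofPred_eq, ← ENNReal.rpow_neg, ENNReal.rpow_neg, ENNReal.rpow_neg,
    ENNReal.inv_le_inv]
  refine ENNReal.rpow_le_rpow ?_ hθ
  rw [← ofReal_norm, Real.norm_eq_abs]
  exact ENNReal.ofReal_le_ofReal ht.2

/-- for a.e. `u ∈ ℝⁿ`: for every `θ ∈ (0,1)` there is `C_{u,θ}` such that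
`|{t ∈ [-1,1]ⁿ : |det Q_u(·,t)| ≤ ε}| ≤ C_{u,θ} ε^θ` for all `ε > 0`. -/
theorem ae_sublevel_estimate (n : ℕ) (hn : 1 ≤ n)
    (Q : (Fin n → ℝ) →ₗ[ℝ] (Fin n → ℝ) →ₗ[ℝ] (Fin n → ℝ)) :
    ∀ᵐ u ∂(volume : Measure (Fin n → ℝ)),
      ∀ θ : ℝ, θ ∈ Set.Ioo (0 : ℝ) 1 →
        ∃ C : ℝ, ∀ ε : ℝ, 0 < ε →
          volume {t ∈ Set.Icc (-1 : Fin n → ℝ) 1 | |LinearMap.det (QuFlip Q u t)| ≤ ε}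
            ≤ ENNReal.ofReal (C * ε ^ θ) := by
  have hae : ∀ᵐ u ∂(volume : Measure (Fin n → ℝ)), ∀ k : ℕ,
      ∫⁻ t in Set.Icc (-1 : Fin n → ℝ) 1,
        ‖LinearMap.det (QuFlip Q u t)‖ₑ ^ (-(1 - 1 / ((k : ℝ) + 1))) ≠ ∞ := by
    refine ae_all_iff.2 fun k => ae_lintegral_det_QuFlip_ne_top Q ?_ ?_
    · rw [sub_nonneg, div_le_one (by positivity)]
      linarith [k.cast_nonneg (α := ℝ)]
    · have : (0 : ℝ) < 1 / ((k : ℝ) + 1) := by positivity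
      linarith
  filter_upwards [hae] with u hu θ hθ
  obtain ⟨k, hk⟩ := exists_nat_one_div_lt (sub_pos.2 hθ.2)
  have hI : ∫⁻ t in Set.Icc (-1 : Fin n → ℝ) 1, ‖LinearMap.det (QuFlip Q u t)‖ₑ ^ (-θ) ≠ ∞ := by
    refine ne_top_of_le_ne_top ?_ (lintegral_mono fun t =>
      ENNReal.rpow_neg_le_one_add_rpow_neg hθ.1.le
        (show θ ≤ 1 - 1 / ((k : ℝ) + 1) by linarith) _)
    rw [lintegral_add_left measurable_const, setLIntegral_const, one_mul]
    exact ENNReal.add_ne_top.2 ⟨isCompact_Icc.measure_lt_top.ne, hu k⟩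
  have hf : Measurable fun t => LinearMap.det (QuFlip Q u t) :=
    ((continuous_det_QuFlip Q).comp (Continuous.prodMk_right u)).measurable
  exact ⟨_, fun ε hε =>
    measure_sublevel_le_of_lintegral_rpow_neg measurableSet_Icc hf hθ.1.le hI hε⟩
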